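/- arXiv:2602.18053 — 7 statements merged into one kernel-verified Lean document; each statement's English description precedes it below -/
import Mathlib

section
/- Let l be a nonnegative random variable on a probability space satisfying E[l^{1+λ}] ≤ M for some λ ∈ (0,1] and M > 0, and fix α ∈ (0,1). Define F(θ) := θ + (1/α)·E[(l − θ)_+] for θ ∈ ℝ. Then F attains its minimum on ℝ, and every minimizer θ* of F satisfies 0 ≤ θ* ≤ M^{1/(1+λ)}/α. -/
open MeasureTheory Real Set

/-- **Boundedness of the CVaR minimizer under a bounded moment.**
Let `l ≥ 0` be a random variable on a probability space with `E[l^(1+λ)] ≤ M` for some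
`λ ∈ (0,1]` and `M > 0`, and fix `α ∈ (0,1)`.  Define `F θ = θ + (1/α) E[(l - θ)₊]`.
Then `F` attains its minimum on `ℝ`, and every minimizer `θ*` satisfies
`0 ≤ θ* ≤ M^(1/(1+λ)) / α`. -/
theorem cvar_minimizer_bounded
    {Ω : Type*} [MeasurableSpace Ω] (μ : Measure Ω) [IsProbabilityMeasure μ]
    (l : Ω → ℝ) (hl_meas : Measurable l) (hl_nonneg : ∀ ω, 0 ≤ l ω)
    (lam M α : ℝ) (hlam : lam ∈ Set.Ioc (0 : ℝ) 1) (hM : 0 < M)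
    (hα : α ∈ Set.Ioo (0 : ℝ) 1)
    (hmom_int : Integrable (fun ω => l ω ^ (1 + lam)) μ)
    (hmom : ∫ ω, l ω ^ (1 + lam) ∂μ ≤ M)
    (F : ℝ → ℝ) (hF : F = fun θ : ℝ => θ + (1 / α) * ∫ ω, max (l ω - θ) 0 ∂μ) :
    (∃ θstar : ℝ, ∀ θ : ℝ, F θstar ≤ F θ) ∧
    (∀ θstar : ℝ, (∀ θ : ℝ, F θstar ≤ F θ) →
      0 ≤ θstar ∧ θstar ≤ M ^ (1 / (1 + lam)) / α) := by
  obtain ⟨hl0, hl1⟩ := hlam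
  obtain ⟨ha0, ha1⟩ := hα
  have hp : (1 : ℝ) ≤ 1 + lam := by linarith
  have hint : Integrable l μ := by
    refine Integrable.mono' ((integrable_const (1 : ℝ)).add hmom_int)
      hl_meas.aestronglyMeasurable (Filter.Eventually.of_forall fun ω => ?_)
    have h0 := hl_nonneg ω
    have h1 : 0 ≤ l ω ^ (1 + lam) := Real.rpow_nonneg h0 _
    rw [Real.norm_of_nonneg h0]
    simp only [Pi.add_apply]
    rcases le_total (l ω) 1 with h | h
    · linarith
    · have := Real.self_le_rpow_of_one_le h hp
      linarith
  have hG : ∀ θ : ℝ, Integrable (fun ω => max (l ω - θ) 0) μ := fun θ =>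
    (hint.sub (integrable_const θ)).pos_part
  have hB : 0 < M ^ (1 / (1 + lam)) := Real.rpow_pos_of_pos hM _
  have hBp : (M ^ (1 / (1 + lam))) ^ (1 + lam) = M := by
    rw [← Real.rpow_mul hM.le, one_div_mul_cancel (by linarith), Real.rpow_one]
  set B := M ^ (1 / (1 + lam)) with hBdef
  have hmB : ∫ ω, l ω ∂μ ≤ B := by
    have h1 : ∫ ω, (1 + (1 + lam) * (l ω / B - 1)) ∂μ ≤ ∫ ω, l ω ^ (1 + lam) / M ∂μ := by
      refine integral_mono ?_ (hmom_int.div_const M) fun ω => ?_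
      · exact (integrable_const _).add
          (((hint.div_const B).sub (integrable_const _)).const_mul _)
      · have h0 : 0 ≤ l ω / B := div_nonneg (hl_nonneg ω) hB.le
        have h2 := one_add_mul_self_le_rpow_one_add (s := l ω / B - 1) (by linarith) hp
        rw [add_sub_cancel, Real.div_rpow (hl_nonneg ω) hB.le, hBp] at h2
        exact h2
    have e1 : ∫ ω, (1 + (1 + lam) * (l ω / B - 1)) ∂μ
        = 1 + (1 + lam) * ((∫ ω, l ω ∂μ) / B - 1) := by
      have hi : Integrable (fun ω => (1 + lam) * (l ω / B - 1)) μ :=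
        ((hint.div_const B).sub (integrable_const _)).const_mul _
      rw [integral_add (integrable_const _) hi, integral_const_mul,
        integral_sub (hint.div_const B) (integrable_const _), integral_div]
      simp
    rw [e1, integral_div] at h1
    have h3 : (∫ ω, l ω ^ (1 + lam) ∂μ) / M ≤ 1 := (div_le_one hM).2 hmom
    have h4 : (∫ ω, l ω ∂μ) / B ≤ 1 := by nlinarith
    exact (div_le_one hB).1 h4
  have hlow : ∀ θ, θ ≤ F θ := by
    intro θ
    have : 0 ≤ (1 / α) * ∫ ω, max (l ω - θ) 0 ∂μ :=
      mul_nonneg (by positivity) (integral_nonneg fun ω => le_max_right _ _)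
    rw [hF]
    simp only
    linarith
  have hneg : ∀ θ ≤ 0, F θ = θ + (1 / α) * ((∫ ω, l ω ∂μ) - θ) := by
    intro θ hθ
    have : ∫ ω, max (l ω - θ) 0 ∂μ = (∫ ω, l ω ∂μ) - θ := by
      have : ∀ ω, max (l ω - θ) 0 = l ω - θ := fun ω =>
        max_eq_left (by linarith [hl_nonneg ω])
      simp_rw [this]
      rw [integral_sub hint (integrable_const _)]
      simp
    rw [hF]
    simp only [this]
  have hF0 : F 0 = (∫ ω, l ω ∂μ) / α := by
    rw [hneg 0 le_rfl]; ring
  have hlt : ∀ θ < 0, F 0 < F θ := by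
    intro θ hθ
    rw [hneg 0 le_rfl, hneg θ hθ.le]
    have : 1 < 1 / α := (one_lt_div ha0).2 ha1
    nlinarith
  have hcont : Continuous F := by
    have hL : LipschitzWith 1 (fun θ : ℝ => ∫ ω, max (l ω - θ) 0 ∂μ) := by
      refine LipschitzWith.of_le_add fun x y => ?_
      have h1 : ∫ ω, max (l ω - x) 0 ∂μ ≤ ∫ ω, (max (l ω - y) 0 + dist x y) ∂μ := by
        refine integral_mono (hG x) ((hG y).add (integrable_const _)) fun ω => ?_
        have h2 : y - x ≤ dist x y := by
          rw [Real.dist_eq, abs_sub_comm]; exact le_abs_self _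
        have h3 : 0 ≤ dist x y := dist_nonneg
        have h4 := le_max_left (l ω - y) 0
        have h5 := le_max_right (l ω - y) 0
        exact max_le (by linarith) (by linarith)
      rw [integral_add (hG y) (integrable_const _)] at h1
      simpa using h1
    rw [hF]
    exact continuous_id.add (continuous_const.mul hL.continuous)
  have hF0n : 0 ≤ F 0 := hlow 0
  refine ⟨?_, ?_⟩
  · obtain ⟨x, hx, hmin⟩ := (isCompact_Icc (a := (0 : ℝ)) (b := F 0)).exists_isMinOn
      ⟨0, le_rfl, hF0n⟩ hcont.continuousOn
    have hx0 : F x ≤ F 0 := hmin ⟨le_rfl, hF0n⟩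
    refine ⟨x, fun θ => ?_⟩
    by_cases h : 0 ≤ θ
    · by_cases h' : θ ≤ F 0
      · exact hmin ⟨h, h'⟩
      · linarith [hlow θ]
    · linarith [hlt θ (not_le.1 h)]
  · intro x hx
    refine ⟨?_, ?_⟩
    · by_contra h
      linarith [hlt x (not_le.1 h), hx 0]
    · calc x ≤ F x := hlow x
        _ ≤ F 0 := hx 0
        _ = (∫ ω, l ω ∂μ) / α := hF0
        _ ≤ B / α := by gcongr
end

section
/- Fix α ∈ (0,1) and λ ∈ (0,1]. Let P and Q be probability measures on a measurable space Z, let H be an index set, and let ℓ : H × Z → [0,∞) satisfy, for every h ∈ H, that ℓ(h,·) is measurable with E_P[ℓ(h,Z)^{1+λ}] ≤ M and E_Q[ℓ(h,Z)^{1+λ}] ≤ M. Then sup_{h ∈ H} | R_α^P(h) − R_α^Q(h) | ≤ (C/α)·d_TV(P,Q)^{λ/(1+λ)}, where C := (2M)^{1/(1+λ)}·(1 + 1/λ). -/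
open MeasureTheory Real Set

/-- Hölder-type comparison of integrals under two probability measures. -/
lemma integral_sub_le_of_moment {Z : Type*} [MeasurableSpace Z]
    (lam M d : ℝ) (hlam : 0 < lam) (hM : 0 < M)
    (P Q : Measure Z) [IsProbabilityMeasure P] [IsProbabilityMeasure Q]
    (f g : Z → ℝ) (hf : Measurable f) (hg : Measurable g) (hf0 : ∀ z, 0 ≤ f z)
    (hfg : ∀ z, f z ≤ g z)
    (hgP : Integrable (fun z => g z ^ (1 + lam)) P)
    (hgM : ∫ z, g z ^ (1 + lam) ∂P ≤ M)
    (hfP : Integrable f P) (hfQ : Integrable f Q)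
    (hd : ∀ A, MeasurableSet A → |(P A).toReal - (Q A).toReal| ≤ d) :
    ∫ z, f z ∂P - ∫ z, f z ∂Q ≤ M ^ (1 / (1 + lam)) * d ^ (lam / (1 + lam)) := by
  obtain ⟨s, hs, h1, h2⟩ := hahn_decomposition P Q
  have hle : Q.restrict s ≤ P.restrict s := by
    refine Measure.le_iff.2 fun t ht => ?_
    rw [Measure.restrict_apply ht, Measure.restrict_apply ht]
    exact h1 _ (ht.inter hs) inter_subset_right
  have hle' : P.restrict sᶜ ≤ Q.restrict sᶜ := by
    refine Measure.le_iff.2 fun t ht => ?_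
    rw [Measure.restrict_apply ht, Measure.restrict_apply ht]
    exact h2 _ (ht.inter hs.compl) inter_subset_right
  set ν := P.restrict s - Q.restrict s with hν
  have hadd : ν + Q.restrict s = P.restrict s := Measure.sub_add_cancel_of_le hle
  have hνP : ν ≤ P := Measure.sub_le.trans Measure.restrict_le_self
  have hfin : IsFiniteMeasure ν := isFiniteMeasure_of_le P hνP
  have hmass : ν.real univ ≤ d := by
    have h3 : ν.real univ + Q.real s = P.real s := by
      have := congrArg (fun m : Measure Z => m.real univ) hadd
      simpa [measureReal_add_apply] using this
    have h4 := (abs_le.1 (hd s hs)).2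
    simp only [Measure.real] at h3 ⊢
    linarith
  have hfν : Integrable f ν := hfP.mono_measure hνP
  have e1 : ∫ z, f z ∂P - ∫ z, f z ∂Q ≤ ∫ z, f z ∂ν := by
    rw [← integral_add_compl hs hfP, ← integral_add_compl hs hfQ, ← hadd,
      integral_add_measure hfν hfQ.integrableOn]
    have : ∫ z in sᶜ, f z ∂P ≤ ∫ z in sᶜ, f z ∂Q :=
      integral_mono_measure hle' (Filter.Eventually.of_forall hf0) hfQ.integrableOn
    linarith
  have hp : 0 < 1 + lam := by linarith
  have hpow : ∀ z, f z ^ (1 + lam) ≤ g z ^ (1 + lam) := fun z =>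
    Real.rpow_le_rpow (hf0 z) (hfg z) hp.le
  have hfpP : Integrable (fun z => f z ^ (1 + lam)) P := by
    refine hgP.mono' (hf.pow_const _).aestronglyMeasurable (Filter.Eventually.of_forall fun z => ?_)
    rw [Real.norm_of_nonneg (Real.rpow_nonneg (hf0 z) _)]
    exact hpow z
  have hpq : (1 + lam).HolderConjugate ((1 + lam) / lam) := by
    rw [Real.holderConjugate_iff]
    refine ⟨by linarith, ?_⟩
    field_simp
  have hmem : MemLp f (ENNReal.ofReal (1 + lam)) ν := by
    rw [← integrable_norm_rpow_iff hf.aestronglyMeasurable (by simpa using hp) (by simp),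
      ENNReal.toReal_ofReal hp.le]
    refine (hfpP.mono_measure hνP).congr (Filter.Eventually.of_forall fun z => ?_)
    simp [abs_of_nonneg (hf0 z)]
  have hH := integral_mul_le_Lp_mul_Lq_of_nonneg (μ := ν) hpq (f := f) (g := fun _ => (1 : ℝ))
    (Filter.Eventually.of_forall hf0) (Filter.Eventually.of_forall fun _ => zero_le_one) hmem
    (memLp_const 1)
  simp only [mul_one, Real.one_rpow, integral_const, smul_eq_mul, one_div_div] at hH
  refine e1.trans (hH.trans ?_)
  have hI : ∫ z, f z ^ (1 + lam) ∂ν ≤ M :=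
    calc ∫ z, f z ^ (1 + lam) ∂ν ≤ ∫ z, f z ^ (1 + lam) ∂P :=
          integral_mono_measure hνP
            (Filter.Eventually.of_forall fun z => Real.rpow_nonneg (hf0 z) _) hfpP
      _ ≤ ∫ z, g z ^ (1 + lam) ∂P := integral_mono hfpP hgP hpow
      _ ≤ M := hgM
  have hI0 : 0 ≤ ∫ z, f z ^ (1 + lam) ∂ν :=
    integral_nonneg fun z => Real.rpow_nonneg (hf0 z) _
  have hm0 : 0 ≤ ν.real univ := measureReal_nonneg
  gcongr

lemma integrable_of_moment {Z : Type*} [MeasurableSpace Z]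
    (lam : ℝ) (hlam : 0 < lam) (P : Measure Z) [IsProbabilityMeasure P]
    (g : Z → ℝ) (hg : Measurable g) (hg0 : ∀ z, 0 ≤ g z)
    (hgP : Integrable (fun z => g z ^ (1 + lam)) P) : Integrable g P := by
  refine ((integrable_const (1 : ℝ)).add hgP).mono' hg.aestronglyMeasurable
    (Filter.Eventually.of_forall fun z => ?_)
  rw [Real.norm_of_nonneg (hg0 z)]
  simp only [Pi.add_apply]
  have h0 := Real.rpow_nonneg (hg0 z) (1 + lam)
  rcases le_total (g z) 1 with h | h
  · linarith
  · have := Real.self_le_rpow_of_one_le h (by linarith : 1 ≤ 1 + lam)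
    linarith

/-- One-sided bound for the CVaR infima. -/
lemma cvar_le_add {Z : Type*} [MeasurableSpace Z]
    (α lam M d : ℝ) (hα : 0 < α) (hα1 : α < 1) (hlam : 0 < lam) (hM : 0 < M)
    (P Q : Measure Z) [IsProbabilityMeasure P] [IsProbabilityMeasure Q]
    (g : Z → ℝ) (hg : Measurable g) (hg0 : ∀ z, 0 ≤ g z)
    (hgP : Integrable (fun z => g z ^ (1 + lam)) P)
    (hgM : ∫ z, g z ^ (1 + lam) ∂P ≤ M)
    (hgQ : Integrable (fun z => g z ^ (1 + lam)) Q)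
    (hd : ∀ A, MeasurableSet A → |(P A).toReal - (Q A).toReal| ≤ d) :
    (⨅ θ : ℝ, θ + (1 / α) * ∫ z, max (g z - θ) 0 ∂P)
      ≤ (⨅ θ : ℝ, θ + (1 / α) * ∫ z, max (g z - θ) 0 ∂Q)
        + (1 / α) * (M ^ (1 / (1 + lam)) * d ^ (lam / (1 + lam))) := by
  have hiP := integrable_of_moment lam hlam P g hg hg0 hgP
  have hiQ := integrable_of_moment lam hlam Q g hg hg0 hgQ
  have mP : ∀ θ : ℝ, Integrable (fun z => max (g z - θ) 0) P := fun θ =>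
    (hiP.sub (integrable_const θ)).pos_part
  have mQ : ∀ θ : ℝ, Integrable (fun z => max (g z - θ) 0) Q := fun θ =>
    (hiQ.sub (integrable_const θ)).pos_part
  have hα' : 1 ≤ 1 / α := by rw [le_div_iff₀ hα]; linarith
  have hbdd : BddBelow (range fun θ : ℝ => θ + (1 / α) * ∫ z, max (g z - θ) 0 ∂P) := by
    refine ⟨0, ?_⟩
    rintro _ ⟨θ, rfl⟩
    have h1 : max (-θ) 0 ≤ ∫ z, max (g z - θ) 0 ∂P := by
      have := integral_mono (μ := P) (integrable_const (max (-θ) 0)) (mP θ)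
        (fun z => max_le_max (by linarith [hg0 z]) le_rfl)
      simpa using this
    have h2 : 0 ≤ max (-θ) 0 := le_max_right _ _
    have h3 : -θ ≤ max (-θ) 0 := le_max_left _ _
    have h4 := mul_le_mul_of_nonneg_right hα' (h2.trans h1)
    dsimp only
    linarith
  rw [← sub_le_iff_le_add]
  refine le_ciInf fun θ => ?_
  rw [sub_le_iff_le_add]
  refine (ciInf_le hbdd θ).trans ?_
  have key := integral_sub_le_of_moment lam M d hlam hM P Q
    (fun z => max (g z - θ) 0 - max (-θ) 0) g
    (((hg.sub_const θ).max measurable_const).sub_const _) hg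
    (fun z => sub_nonneg.2 (max_le_max (by linarith [hg0 z]) le_rfl))
    (fun z => by
      have h2 : 0 ≤ max (-θ) 0 := le_max_right _ _
      have h3 : -θ ≤ max (-θ) 0 := le_max_left _ _
      have : max (g z - θ) 0 ≤ g z + max (-θ) 0 := max_le (by linarith) (by linarith [hg0 z])
      linarith)
    hgP hgM ((mP θ).sub (integrable_const _)) ((mQ θ).sub (integrable_const _)) hd
  rw [integral_sub (mP θ) (integrable_const _), integral_sub (mQ θ) (integrable_const _)] at key
  simp only [integral_const, probReal_univ, smul_eq_mul, one_mul] at key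
  have h5 := mul_le_mul_of_nonneg_left key (by linarith : 0 ≤ 1 / α)
  linarith

/-- **Total-variation robustness of CVaR under heavy tails.**
For `α ∈ (0,1)`, `λ ∈ (0,1]`, probability measures `P, Q` on `Z`, and a nonnegative
loss `ℓ(h,·)` with `(1+λ)`-moments bounded by `M` under both `P` and `Q` for every `h`,
`sup_h |R_α^P(h) - R_α^Q(h)| ≤ (C/α) d_TV(P,Q)^(λ/(1+λ))`,
where `C = (2M)^(1/(1+λ)) (1 + 1/λ)` and `d_TV(P,Q) = sup_A |P(A) - Q(A)|`. -/
theorem cvar_tv_robustness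
    {Z : Type*} [MeasurableSpace Z] {H : Type*}
    (α lam M : ℝ) (hα : α ∈ Set.Ioo (0 : ℝ) 1) (hlam : lam ∈ Set.Ioc (0 : ℝ) 1)
    (hM : 0 < M)
    (P Q : Measure Z) [IsProbabilityMeasure P] [IsProbabilityMeasure Q]
    (ℓ : H → Z → ℝ) (hℓmeas : ∀ h, Measurable (ℓ h)) (hℓnonneg : ∀ h z, 0 ≤ ℓ h z)
    (hPint : ∀ h, Integrable (fun z => ℓ h z ^ (1 + lam)) P)
    (hPmom : ∀ h, ∫ z, ℓ h z ^ (1 + lam) ∂P ≤ M)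
    (hQint : ∀ h, Integrable (fun z => ℓ h z ^ (1 + lam)) Q)
    (hQmom : ∀ h, ∫ z, ℓ h z ^ (1 + lam) ∂Q ≤ M) :
    ∀ h : H,
      |(⨅ θ : ℝ, θ + (1 / α) * ∫ z, max (ℓ h z - θ) 0 ∂P)
        - (⨅ θ : ℝ, θ + (1 / α) * ∫ z, max (ℓ h z - θ) 0 ∂Q)|
      ≤ ((2 * M) ^ (1 / (1 + lam)) * (1 + 1 / lam) / α) *
          (⨆ A ∈ {A : Set Z | MeasurableSet A}, |(P A).toReal - (Q A).toReal|)
            ^ (lam / (1 + lam)) := by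
  intro h
  obtain ⟨hα0, hα1⟩ := hα
  obtain ⟨hl0, hl1⟩ := hlam
  set d := ⨆ A ∈ {A : Set Z | MeasurableSet A}, |(P A).toReal - (Q A).toReal| with hd_def
  have hb1 : ∀ A : Set Z, |(P A).toReal - (Q A).toReal| ≤ 1 := fun A => by
    have a1 : P.real A ≤ 1 := measureReal_le_one
    have a2 : Q.real A ≤ 1 := measureReal_le_one
    have a3 : 0 ≤ P.real A := measureReal_nonneg
    have a4 : 0 ≤ Q.real A := measureReal_nonneg
    simp only [Measure.real] at a1 a2 a3 a4
    rw [abs_le]; constructor <;> linarith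
  have hd : ∀ A, MeasurableSet A → |(P A).toReal - (Q A).toReal| ≤ d := by
    intro A hA
    have hbdd : BddAbove (range fun A : Set Z =>
        ⨆ _ : A ∈ {A : Set Z | MeasurableSet A}, |(P A).toReal - (Q A).toReal|) := by
      refine ⟨1, ?_⟩
      rintro _ ⟨B, rfl⟩
      exact Real.iSup_le (fun _ => hb1 B) zero_le_one
    have := le_ciSup hbdd A
    have hA' : A ∈ {A : Set Z | MeasurableSet A} := hA
    have e : (⨆ _ : A ∈ {A : Set Z | MeasurableSet A}, |(P A).toReal - (Q A).toReal|)
        = |(P A).toReal - (Q A).toReal| := ciSup_pos hA'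
    exact e.symm.le.trans this
  have hd' : ∀ A, MeasurableSet A → |(Q A).toReal - (P A).toReal| ≤ d := fun A hA => by
    rw [abs_sub_comm]; exact hd A hA
  have hd0 : 0 ≤ d := (abs_nonneg _).trans (hd univ MeasurableSet.univ)
  have k1 := cvar_le_add α lam M d hα0 hα1 hl0 hM P Q (ℓ h) (hℓmeas h) (hℓnonneg h)
    (hPint h) (hPmom h) (hQint h) hd
  have k2 := cvar_le_add α lam M d hα0 hα1 hl0 hM Q P (ℓ h) (hℓmeas h) (hℓnonneg h)
    (hQint h) (hQmom h) (hPint h) hd'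
  have hC : (1 / α) * (M ^ (1 / (1 + lam)) * d ^ (lam / (1 + lam)))
      ≤ ((2 * M) ^ (1 / (1 + lam)) * (1 + 1 / lam) / α) * d ^ (lam / (1 + lam)) := by
    have c1 : M ^ (1 / (1 + lam)) ≤ (2 * M) ^ (1 / (1 + lam)) :=
      Real.rpow_le_rpow hM.le (by linarith) (by positivity)
    have c2 : (2 * M) ^ (1 / (1 + lam)) ≤ (2 * M) ^ (1 / (1 + lam)) * (1 + 1 / lam) := by
      refine le_mul_of_one_le_right (by positivity) ?_
      have : 0 < 1 / lam := by positivity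
      linarith
    have c3 := c1.trans c2
    calc (1 / α) * (M ^ (1 / (1 + lam)) * d ^ (lam / (1 + lam)))
        = (M ^ (1 / (1 + lam)) / α) * d ^ (lam / (1 + lam)) := by ring
      _ ≤ _ := by gcongr
  rw [abs_le]
  constructor <;> linarith
end

section
/- Fix α ∈ (0,1), λ ∈ (0,1], and M > 0. For every ε ∈ (0, α) there exist Borel probability measures P and Q on ℝ, each supported on [0,∞), such that: the identity loss satisfies E_P[|x|^{1+λ}] ≤ M and E_Q[|x|^{1+λ}] ≤ M; the total variation distance satisfies d_TV(P,Q) = ε; and CVaR_α(id; Q) − CVaR_α(id; P) = (M^{1/(1+λ)}/α)·ε^{λ/(1+λ)}. In particular, the Hölder exponent λ/(1+λ) in the total-variation robustness bound for CVaR cannot be improved. -/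
open MeasureTheory Real Set


lemma two_point_integrable (a c b : ℝ) (f : ℝ → ℝ) :
    Integrable f (ENNReal.ofReal a • Measure.dirac (0 : ℝ) + ENNReal.ofReal c • Measure.dirac b) := by
  have h0 : Integrable f (Measure.dirac (0 : ℝ)) := integrable_dirac (by simp)
  have hb : Integrable f (Measure.dirac b) := integrable_dirac (by simp)
  exact (h0.smul_measure ENNReal.ofReal_ne_top).add_measure (hb.smul_measure ENNReal.ofReal_ne_top)

lemma two_point_integral (a c b : ℝ) (ha : 0 ≤ a) (hc : 0 ≤ c) (f : ℝ → ℝ) :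
    ∫ x, f x ∂(ENNReal.ofReal a • Measure.dirac (0 : ℝ) + ENNReal.ofReal c • Measure.dirac b)
      = a * f 0 + c * f b := by
  have h0 : Integrable f (Measure.dirac (0 : ℝ)) := integrable_dirac (by simp)
  have hb : Integrable f (Measure.dirac b) := integrable_dirac (by simp)
  rw [integral_add_measure (h0.smul_measure ENNReal.ofReal_ne_top)
    (hb.smul_measure ENNReal.ofReal_ne_top), integral_smul_measure, integral_smul_measure,
    integral_dirac, integral_dirac, ENNReal.toReal_ofReal ha, ENNReal.toReal_ofReal hc]
  simp

lemma iInf_eq_of_min (g : ℝ → ℝ) (m : ℝ) (h0 : g 0 = m) (h : ∀ θ, m ≤ g θ) :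
    (⨅ θ : ℝ, g θ) = m := by
  apply le_antisymm
  · rw [← h0]
    exact ciInf_le ⟨m, by rintro _ ⟨θ, rfl⟩; exact h θ⟩ 0
  · exact le_ciInf h

/-- **Minimax optimality of the TV-robustness exponent for CVaR.**
For `α ∈ (0,1)`, `λ ∈ (0,1]`, `M > 0`, and every `ε ∈ (0,α)`, there exist Borel
probability measures `P, Q` on `ℝ` supported on `[0,∞)` with `(1+λ)`-moments bounded
by `M`, total-variation distance exactly `ε`, and
`CVaR_α(id;Q) - CVaR_α(id;P) = (M^(1/(1+λ))/α) ε^(λ/(1+λ))`.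
Hence the Hölder exponent `λ/(1+λ)` cannot be improved. -/
theorem cvar_tv_lower_bound_construction
    (α lam M : ℝ) (hα : α ∈ Set.Ioo (0 : ℝ) 1) (hlam : lam ∈ Set.Ioc (0 : ℝ) 1)
    (hM : 0 < M) (ε : ℝ) (hε : ε ∈ Set.Ioo (0 : ℝ) α) :
    ∃ P Q : Measure ℝ, IsProbabilityMeasure P ∧ IsProbabilityMeasure Q ∧
      P (Set.Iio 0) = 0 ∧ Q (Set.Iio 0) = 0 ∧
      Integrable (fun x => |x| ^ (1 + lam)) P ∧ (∫ x, |x| ^ (1 + lam) ∂P) ≤ M ∧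
      Integrable (fun x => |x| ^ (1 + lam)) Q ∧ (∫ x, |x| ^ (1 + lam) ∂Q) ≤ M ∧
      (⨆ A ∈ {A : Set ℝ | MeasurableSet A}, |(P A).toReal - (Q A).toReal|) = ε ∧
      (⨅ θ : ℝ, θ + (1 / α) * ∫ x, max (x - θ) 0 ∂Q)
        - (⨅ θ : ℝ, θ + (1 / α) * ∫ x, max (x - θ) 0 ∂P)
        = (M ^ (1 / (1 + lam)) / α) * ε ^ (lam / (1 + lam)) := by
  obtain ⟨hα0, hα1⟩ := hα
  obtain ⟨hl0, hl1⟩ := hlam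
  obtain ⟨hε0, hεα⟩ := hε
  have hp : (0 : ℝ) < 1 + lam := by linarith
  set b : ℝ := (M / ε) ^ (1 / (1 + lam)) with hb
  have hMε : 0 < M / ε := div_pos hM hε0
  have hb0 : 0 < b := Real.rpow_pos_of_pos hMε _
  have hbp : b ^ (1 + lam) = M / ε := by
    rw [hb, ← Real.rpow_mul hMε.le, one_div_mul_cancel hp.ne', Real.rpow_one]
  have h1ε : 0 ≤ 1 - ε := by linarith
  have hεb : ε * b = M ^ (1 / (1 + lam)) * ε ^ (lam / (1 + lam)) := by
    have : lam / (1 + lam) = 1 - 1 / (1 + lam) := by field_simp; ring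
    rw [hb, Real.div_rpow hM.le hε0.le, this, Real.rpow_sub hε0, Real.rpow_one]
    ring
  have hQA : ∀ A : Set ℝ, MeasurableSet A →
      ((ENNReal.ofReal (1 - ε) • Measure.dirac (0 : ℝ) + ENNReal.ofReal ε • Measure.dirac b) A).toReal
        = (1 - ε) * A.indicator 1 0 + ε * A.indicator 1 b := by
    intro A hA
    by_cases h0 : (0 : ℝ) ∈ A <;> by_cases h1 : b ∈ A <;>
      simp [Measure.dirac_apply' _ hA, h0, h1, ENNReal.toReal_add, h1ε, hε0.le]
  have hPA : ∀ A : Set ℝ, MeasurableSet A →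
      ((Measure.dirac (0 : ℝ)) A).toReal = A.indicator 1 0 := by
    intro A hA
    by_cases h0 : (0 : ℝ) ∈ A <;> simp [Measure.dirac_apply' _ hA, h0]
  refine ⟨Measure.dirac 0,
    ENNReal.ofReal (1 - ε) • Measure.dirac (0 : ℝ) + ENNReal.ofReal ε • Measure.dirac b,
    inferInstance, ⟨?_⟩, ?_, ?_, ?_, ?_, ?_, ?_, ?_, ?_⟩
  · simp only [Measure.add_apply, Measure.smul_apply, measure_univ, smul_eq_mul, mul_one]
    rw [← ENNReal.ofReal_add h1ε hε0.le]
    simp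
  · simp [Measure.dirac_apply' _ measurableSet_Iio]
  · simp [Measure.dirac_apply' _ measurableSet_Iio, hb0.le]
  · exact integrable_dirac (by simp)
  · rw [integral_dirac, abs_zero, Real.zero_rpow hp.ne']
    exact hM.le
  · exact two_point_integrable _ _ _ _
  · rw [two_point_integral _ _ _ h1ε hε0.le, abs_zero, Real.zero_rpow hp.ne', abs_of_pos hb0, hbp]
    apply le_of_eq
    field_simp
    ring
  · have hle : ∀ A : Set ℝ, (⨆ (_ : A ∈ {A : Set ℝ | MeasurableSet A}),
        |((Measure.dirac (0 : ℝ)) A).toReal - ((ENNReal.ofReal (1 - ε) • Measure.dirac (0 : ℝ)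
          + ENNReal.ofReal ε • Measure.dirac b) A).toReal|) ≤ ε := by
      intro A
      apply Real.iSup_le _ hε0.le
      intro hA
      rw [hQA A hA, hPA A hA]
      by_cases h0 : (0 : ℝ) ∈ A <;> by_cases h1 : b ∈ A <;>
        simp [h0, h1, abs_of_pos hε0, hε0.le]
    apply le_antisymm (Real.iSup_le hle hε0.le)
    refine le_trans ?_ (le_ciSup ⟨ε, by rintro _ ⟨A, rfl⟩; exact hle A⟩ ({b} : Set ℝ))
    have hm : ({b} : Set ℝ) ∈ {A : Set ℝ | MeasurableSet A} := measurableSet_singleton b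
    rw [ciSup_pos hm, hQA _ hm, hPA _ hm]
    simp [hb0.ne, abs_of_pos hε0]
  · have hα' : 1 < 1 / α := by rw [lt_div_iff₀ hα0]; linarith
    have hεα' : ε / α < 1 := by rw [div_lt_one hα0]; exact hεα
    rw [iInf_eq_of_min _ (1 / α * (ε * b)), iInf_eq_of_min _ 0, hεb]
    · ring
    · simp
    · intro θ
      rw [integral_dirac]
      rcases le_total 0 θ with h | h
      · have : 0 ≤ 1 / α * max (0 - θ) 0 := by positivity
        linarith
      · rw [max_eq_left (by linarith)]
        nlinarith
    · rw [two_point_integral _ _ _ h1ε hε0.le]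
      simp [hb0.le]
    · intro θ
      rw [two_point_integral _ _ _ h1ε hε0.le]
      rcases le_total 0 θ with h | h
      · rw [max_eq_right (by linarith : 0 - θ ≤ 0)]
        have h2 : 1 / α * (ε * (b - θ)) ≤ 1 / α * (ε * max (b - θ) 0) := by
          gcongr
          exact le_max_left _ _
        have h3 : 1 / α * (ε * (b - θ)) = 1 / α * (ε * b) - ε / α * θ := by ring
        nlinarith
      · rw [max_eq_left (by linarith : 0 ≤ 0 - θ), max_eq_left (by linarith : 0 ≤ b - θ)]
        nlinarith
end

section
/- Fix α ∈ (0,1) and λ ∈ (0,1]. Let P and Q be Borel probability measures on ℝ^m, and let ℓ : ℝ^m → [0,∞) be L-Lipschitz with E_P[ℓ^{1+λ}] ≤ M and E_Q[ℓ^{1+λ}] ≤ M. If the Lévy–Prokhorov distance satisfies π(P,Q) ≤ ε for some ε ∈ (0,1], then |CVaR_α(ℓ; P) − CVaR_α(ℓ; Q)| ≤ (1/α)·( 2·L·ε + 2·M^{1/(1+λ)}·ε^{λ/(1+λ)} ). -/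
open MeasureTheory Real Set

lemma aux_bounded {Ω : Type*} [MeasurableSpace Ω] [PseudoMetricSpace Ω] [OpensMeasurableSpace Ω]
    (P Q : Measure Ω) [IsProbabilityMeasure P] [IsProbabilityMeasure Q]
    (L : NNReal) (f : Ω → ℝ) (hf : LipschitzWith L f) (hf0 : ∀ x, 0 ≤ f x)
    (K : ℝ) (hK : 0 ≤ K) (hfK : ∀ x, f x ≤ K) (δ : ℝ) (hδ : 0 < δ)
    (hLP : levyProkhorovEDist P Q < ENNReal.ofReal δ) :
    ∫ x, f x ∂P ≤ ∫ x, f x ∂Q + δ * (L + K) := by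
  have hL : (0 : ℝ) ≤ L := L.2
  let F : BoundedContinuousFunction Ω ℝ := BoundedContinuousFunction.ofNormedAddCommGroup f
    hf.continuous K (fun x => by rw [Real.norm_eq_abs, abs_of_nonneg (hf0 x)]; exact hfK x)
  have hFn : ‖F‖ ≤ K := BoundedContinuousFunction.norm_ofNormedAddCommGroup_le _ hK _
  have h1 := BoundedContinuousFunction.integral_le_of_levyProkhorovEDist_lt P Q hδ hLP F
    (Filter.Eventually.of_forall hf0)
  have hfi : Integrable f Q := F.integrable Q
  have hcake := Integrable.integral_eq_integral_Ioc_meas_le (μ := Q) (f := fun x => f x + L * δ)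
    (M := K + L * δ) (hfi.add (integrable_const _))
    (Filter.Eventually.of_forall fun x => add_nonneg (hf0 x) (by positivity))
    (Filter.Eventually.of_forall fun x => by simpa using hfK x)
  have hanti : Antitone (fun t : ℝ => Q.real {a | t ≤ f a + L * δ}) := fun s t hst =>
    measureReal_mono (fun x (hx : t ≤ _) => hst.trans hx)
  have hanti2 : Antitone (fun t : ℝ => Q.real (Metric.thickening δ {a | t ≤ F a})) :=
    fun s t hst => measureReal_mono
      (Metric.thickening_subset_of_subset δ (fun x (hx : t ≤ _) => hst.trans hx))
  have hint : ∀ g : ℝ → ℝ, Antitone g → ∀ b, IntegrableOn g (Ioc 0 b) := fun g hg b =>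
    ((hg.antitoneOn _).integrableOn_isCompact isCompact_Icc).mono_set Ioc_subset_Icc_self
  have h2 : ∫ t in Ioc 0 ‖F‖, Q.real (Metric.thickening δ {a | t ≤ F a})
      ≤ ∫ t in Ioc 0 ‖F‖, Q.real {a | t ≤ f a + L * δ} := by
    apply setIntegral_mono (hint _ hanti2 _) (hint _ hanti _)
    intro t
    refine measureReal_mono ?_
    intro x hx
    obtain ⟨z, hz, hxz⟩ := Metric.mem_thickening_iff.1 hx
    have hz' : t ≤ f z := hz
    have := hf.dist_le_mul z x
    rw [Real.dist_eq, dist_comm] at this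
    have h3 := (le_abs_self _).trans this
    have h4 : (L : ℝ) * dist x z ≤ L * δ := by gcongr
    show t ≤ f x + L * δ
    linarith
  have h3 : ∫ t in Ioc 0 ‖F‖, Q.real {a | t ≤ f a + L * δ}
      ≤ ∫ t in Ioc 0 (K + L * δ), Q.real {a | t ≤ f a + L * δ} := by
    apply setIntegral_mono_set (hint _ hanti _)
    · exact Filter.Eventually.of_forall fun t => measureReal_nonneg
    · exact (Ioc_subset_Ioc_right (hFn.trans (by have := mul_nonneg hL hδ.le; linarith))).eventuallyLE
  rw [← hcake, integral_add hfi (integrable_const _)] at h3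
  simp at h3
  have h4 : δ * ‖F‖ ≤ δ * K := by gcongr
  have h5 : ∫ x, F x ∂P = ∫ x, f x ∂P := rfl
  rw [h5] at h1
  linarith

lemma aux_integrable {Ω : Type*} [MeasurableSpace Ω] (P : Measure Ω) [IsProbabilityMeasure P]
    (ℓ : Ω → ℝ) (hm : Measurable ℓ) (h0 : ∀ x, 0 ≤ ℓ x) (lam : ℝ) (hl : 0 < lam)
    (hi : Integrable (fun x => ℓ x ^ (1 + lam)) P) (θ : ℝ) :
    Integrable (fun x => max (ℓ x - θ) 0) P := by
  have h1 : Integrable ℓ P := by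
    refine (hi.add (integrable_const (1 : ℝ))).mono' hm.aestronglyMeasurable
      (Filter.Eventually.of_forall fun x => ?_)
    rw [Real.norm_eq_abs, abs_of_nonneg (h0 x)]
    show ℓ x ≤ ℓ x ^ (1 + lam) + 1
    rcases le_total (ℓ x) 1 with h | h
    · have := Real.rpow_nonneg (h0 x) (1 + lam); linarith
    · have := Real.rpow_le_rpow_of_exponent_le h (show (1 : ℝ) ≤ 1 + lam by linarith)
      rw [Real.rpow_one] at this; linarith
  exact (h1.sub (integrable_const θ)).pos_part

lemma aux_theta {Ω : Type*} [MeasurableSpace Ω] [PseudoMetricSpace Ω] [BorelSpace Ω]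
    (P Q : Measure Ω) [IsProbabilityMeasure P] [IsProbabilityMeasure Q]
    (L : NNReal) (ℓ : Ω → ℝ) (hLip : LipschitzWith L ℓ) (h0 : ∀ x, 0 ≤ ℓ x)
    (lam M : ℝ) (hlam : 0 < lam) (hM : 0 < M)
    (hPint : Integrable (fun x => ℓ x ^ (1 + lam)) P)
    (hPmom : ∫ x, ℓ x ^ (1 + lam) ∂P ≤ M)
    (hQint : Integrable (fun x => ℓ x ^ (1 + lam)) Q)
    (ε : ℝ) (hε : 0 < ε) (hLP : levyProkhorovDist P Q ≤ ε) (θ : ℝ) (hθ : 0 ≤ θ) :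
    ∫ x, max (ℓ x - θ) 0 ∂P ≤ ∫ x, max (ℓ x - θ) 0 ∂Q +
      (2 * (L : ℝ) * ε + 2 * M ^ (1 / (1 + lam)) * ε ^ (lam / (1 + lam))) := by
  have hm := hLip.continuous.measurable
  have hiP := aux_integrable P ℓ hm h0 lam hlam hPint θ
  have hiQ := aux_integrable Q ℓ hm h0 lam hlam hQint θ
  set K : ℝ := (M / ε) ^ (1 / (1 + lam)) with hKdef
  have hK : 0 < K := by positivity
  have hp : (1 + lam) ≠ 0 := by positivity
  have hKe : ε * K = M ^ (1 / (1 + lam)) * ε ^ (lam / (1 + lam)) := by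
    rw [hKdef, Real.div_rpow hM.le hε.le]
    have : ε = ε ^ (lam / (1 + lam)) * ε ^ (1 / (1 + lam)) := by
      rw [← Real.rpow_add hε, ← add_div, add_comm lam 1, div_self hp, Real.rpow_one]
    have h2 : ε ^ (1 / (1 + lam)) ≠ 0 := by positivity
    rw [mul_div_assoc', div_eq_iff h2]
    calc _ = M ^ (1 / (1 + lam)) * ε := by ring
      _ = M ^ (1 / (1 + lam)) * (ε ^ (lam / (1 + lam)) * ε ^ (1 / (1 + lam))) := by rw [← this]
      _ = _ := by ring
  have hKM : M * K ^ (-lam) = ε * K := by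
    have h1 : K ^ (1 + lam) = M / ε := by
      rw [hKdef, ← Real.rpow_mul (by positivity), one_div_mul_cancel hp, Real.rpow_one]
    rw [Real.rpow_add hK, Real.rpow_one, eq_div_iff hε.ne'] at h1
    rw [Real.rpow_neg hK.le, ← h1]
    have : K ^ lam ≠ 0 := by positivity
    field_simp
  let f : Ω → ℝ := fun x => min (max (ℓ x - θ) 0) K
  have hf : LipschitzWith L f := by
    have h1 : LipschitzWith L (fun x => ℓ x - θ) := by
      simpa [LipschitzWith] using hLip
    exact (h1.max_const 0).min_const K
  have hf0 : ∀ x, 0 ≤ f x := fun x => le_min (le_max_right _ _) hK.le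
  have hfle : ∀ x, f x ≤ max (ℓ x - θ) 0 := fun x => min_le_left _ _
  have hfm : Measurable f := hf.continuous.measurable
  have hfi : ∀ R : Measure Ω, Integrable (fun x => max (ℓ x - θ) 0) R → Integrable f R :=
    fun R hR => hR.mono' hfm.aestronglyMeasurable (Filter.Eventually.of_forall fun x => by
      rw [Real.norm_eq_abs, abs_of_nonneg (hf0 x)]; exact hfle x)
  have hpt : ∀ x, max (ℓ x - θ) 0 ≤ f x + ℓ x ^ (1 + lam) * K ^ (-lam) := by
    intro x
    have hnn : 0 ≤ ℓ x ^ (1 + lam) * K ^ (-lam) :=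
      mul_nonneg (Real.rpow_nonneg (h0 x) _) (by positivity)
    rcases le_total (max (ℓ x - θ) 0) K with h | h
    · have : f x = max (ℓ x - θ) 0 := min_eq_left h
      linarith
    · have h1 : max (ℓ x - θ) 0 ≤ ℓ x := max_le (by linarith) (h0 x)
      have h2 : K ≤ ℓ x := h.trans h1
      have h3 : 0 < ℓ x := hK.trans_le h2
      have h4 : K ^ lam ≤ ℓ x ^ lam := Real.rpow_le_rpow hK.le h2 hlam.le
      have h5 : ℓ x ≤ ℓ x ^ (1 + lam) * K ^ (-lam) := by
        rw [Real.rpow_add h3, Real.rpow_one, Real.rpow_neg hK.le, ← div_eq_mul_inv,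
          le_div_iff₀ (by positivity)]
        gcongr
      have := hf0 x
      linarith
  have hA : ∫ x, max (ℓ x - θ) 0 ∂P ≤ ∫ x, f x ∂P + M * K ^ (-lam) := by
    calc _ ≤ ∫ x, (f x + ℓ x ^ (1 + lam) * K ^ (-lam)) ∂P :=
          integral_mono hiP ((hfi P hiP).add (hPint.mul_const _)) hpt
      _ = ∫ x, f x ∂P + (∫ x, ℓ x ^ (1 + lam) ∂P) * K ^ (-lam) := by
          rw [integral_add (hfi P hiP) (hPint.mul_const _), integral_mul_const]
      _ ≤ _ := by gcongr
  have hB : ∫ x, f x ∂Q ≤ ∫ x, max (ℓ x - θ) 0 ∂Q := integral_mono (hfi Q hiQ) hiQ hfle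
  have hC : ∀ δ ∈ Ioi ε, ∫ x, f x ∂P ≤ ∫ x, f x ∂Q + δ * (L + K) := by
    intro δ hδ
    have hδ' : ε < δ := hδ
    refine aux_bounded P Q L f hf hf0 K hK.le (fun x => min_le_right _ _) δ (hε.trans hδ') ?_
    rw [ENNReal.lt_ofReal_iff_toReal_lt (levyProkhorovEDist_ne_top P Q)]
    exact lt_of_le_of_lt hLP hδ'
  have hD : ∫ x, f x ∂P ≤ ∫ x, f x ∂Q + ε * (L + K) := by
    have ht : Filter.Tendsto (fun δ : ℝ => ∫ x, f x ∂Q + δ * (L + K)) (nhdsWithin ε (Ioi ε))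
        (nhds (∫ x, f x ∂Q + ε * (L + K))) :=
      (Continuous.tendsto (by fun_prop) ε).mono_left nhdsWithin_le_nhds
    exact ge_of_tendsto ht (Filter.eventually_of_mem self_mem_nhdsWithin hC)
  have hLε : 0 ≤ (L : ℝ) * ε := mul_nonneg L.2 hε.le
  rw [hKM] at hA
  rw [mul_assoc 2 (M ^ _), ← hKe]
  linarith

lemma aux_all {Ω : Type*} [MeasurableSpace Ω] [PseudoMetricSpace Ω] [BorelSpace Ω]
    (P Q : Measure Ω) [IsProbabilityMeasure P] [IsProbabilityMeasure Q]
    (L : NNReal) (ℓ : Ω → ℝ) (hLip : LipschitzWith L ℓ) (h0 : ∀ x, 0 ≤ ℓ x)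
    (α lam M : ℝ) (hα : 0 < α) (hα1 : α < 1) (hlam : 0 < lam) (hM : 0 < M)
    (hPint : Integrable (fun x => ℓ x ^ (1 + lam)) P)
    (hPmom : ∫ x, ℓ x ^ (1 + lam) ∂P ≤ M)
    (hQint : Integrable (fun x => ℓ x ^ (1 + lam)) Q)
    (ε : ℝ) (hε : 0 < ε) (hLP : levyProkhorovDist P Q ≤ ε) :
    (⨅ θ : ℝ, θ + (1 / α) * ∫ x, max (ℓ x - θ) 0 ∂P) ≤
    (⨅ θ : ℝ, θ + (1 / α) * ∫ x, max (ℓ x - θ) 0 ∂Q) +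
      (1 / α) * (2 * (L : ℝ) * ε + 2 * M ^ (1 / (1 + lam)) * ε ^ (lam / (1 + lam))) := by
  have hm := hLip.continuous.measurable
  have hth := aux_theta P Q L ℓ hLip h0 lam M hlam hM hPint hPmom hQint ε hε hLP
  have h1α : 1 ≤ 1 / α := by rw [le_div_iff₀ hα]; linarith
  have hneg : ∀ (ν : Measure Ω) [IsProbabilityMeasure ν],
      Integrable (fun x => ℓ x ^ (1 + lam)) ν → ∀ θ ≤ 0,
      ∫ x, max (ℓ x - θ) 0 ∂ν = ∫ x, max (ℓ x - 0) 0 ∂ν - θ := by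
    intro ν _ hR θ hθ
    have hi := aux_integrable ν ℓ hm h0 lam hlam hR 0
    have : (fun x => max (ℓ x - θ) 0) = fun x => max (ℓ x - 0) 0 - θ := by
      funext x
      have := h0 x
      rw [max_eq_left (by linarith), max_eq_left (by linarith)]; ring
    rw [this, integral_sub hi (integrable_const _)]
    simp
  have hbdd : BddBelow (range fun θ : ℝ => θ + (1 / α) * ∫ x, max (ℓ x - θ) 0 ∂P) := by
    refine ⟨0, ?_⟩
    rintro _ ⟨θ, rfl⟩
    have hi := aux_integrable P ℓ hm h0 lam hlam hPint θ
    have hnn : 0 ≤ ∫ x, max (ℓ x - θ) 0 ∂P := integral_nonneg fun x => le_max_right _ _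
    have h2 : -θ ≤ ∫ x, max (ℓ x - θ) 0 ∂P := by
      have := integral_mono (integrable_const (-θ)) hi
        (fun x => show -θ ≤ max (ℓ x - θ) 0 from le_max_of_le_left (by have := h0 x; linarith))
      simpa using this
    have h3 := mul_le_mul_of_nonneg_right h1α hnn
    show 0 ≤ θ + (1 / α) * ∫ x, max (ℓ x - θ) 0 ∂P
    linarith
  rw [← sub_le_iff_le_add]
  refine le_ciInf fun θ => ?_
  rw [sub_le_iff_le_add]
  refine (ciInf_le hbdd θ).trans ?_
  have key : ∫ x, max (ℓ x - θ) 0 ∂P ≤ ∫ x, max (ℓ x - θ) 0 ∂Q +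
      (2 * (L : ℝ) * ε + 2 * M ^ (1 / (1 + lam)) * ε ^ (lam / (1 + lam))) := by
    rcases le_total 0 θ with h | h
    · exact hth θ h
    · rw [hneg P hPint θ h, hneg Q hQint θ h]
      have := hth 0 le_rfl
      linarith
  have := mul_le_mul_of_nonneg_left key (show 0 ≤ 1 / α by linarith)
  rw [mul_add] at this
  linarith

/-- **Lévy–Prokhorov tail-Hölder continuity of CVaR.**
For `α ∈ (0,1)`, `λ ∈ (0,1]`, Borel probability measures `P, Q` on `ℝ^m`, and an
`L`-Lipschitz nonnegative loss `ℓ` with `(1+λ)`-moments bounded by `M` under both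
measures, if the Lévy–Prokhorov distance satisfies `π(P,Q) ≤ ε` with `ε ∈ (0,1]`,
then `|CVaR_α(ℓ;P) - CVaR_α(ℓ;Q)| ≤ (1/α)(2Lε + 2 M^(1/(1+λ)) ε^(λ/(1+λ)))`. -/
theorem cvar_levy_prokhorov_continuity
    (α lam M : ℝ) (hα : α ∈ Set.Ioo (0 : ℝ) 1) (hlam : lam ∈ Set.Ioc (0 : ℝ) 1)
    (hM : 0 < M) (m : ℕ)
    (P Q : Measure (EuclideanSpace ℝ (Fin m)))
    [IsProbabilityMeasure P] [IsProbabilityMeasure Q]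
    (L : NNReal) (ℓ : EuclideanSpace ℝ (Fin m) → ℝ)
    (hLip : LipschitzWith L ℓ) (hℓnonneg : ∀ x, 0 ≤ ℓ x)
    (hPint : Integrable (fun x => ℓ x ^ (1 + lam)) P)
    (hPmom : ∫ x, ℓ x ^ (1 + lam) ∂P ≤ M)
    (hQint : Integrable (fun x => ℓ x ^ (1 + lam)) Q)
    (hQmom : ∫ x, ℓ x ^ (1 + lam) ∂Q ≤ M)
    (ε : ℝ) (hε : ε ∈ Set.Ioc (0 : ℝ) 1)
    (hLP : levyProkhorovDist P Q ≤ ε) :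
    |(⨅ θ : ℝ, θ + (1 / α) * ∫ x, max (ℓ x - θ) 0 ∂P)
      - (⨅ θ : ℝ, θ + (1 / α) * ∫ x, max (ℓ x - θ) 0 ∂Q)|
      ≤ (1 / α) * (2 * (L : ℝ) * ε + 2 * M ^ (1 / (1 + lam)) * ε ^ (lam / (1 + lam))) := by
  have h1 := aux_all P Q L ℓ hLip hℓnonneg α lam M hα.1 hα.2 hlam.1 hM hPint hPmom hQint ε hε.1 hLP
  have h2 := aux_all Q P L ℓ hLip hℓnonneg α lam M hα.1 hα.2 hlam.1 hM hQint hQmom hPint ε hε.1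
    (by rw [levyProkhorovDist_comm]; exact hLP)
  rw [abs_sub_le_iff]
  constructor <;> linarith
end

section
/- Fix α ∈ (0,1), λ ∈ (0,1], and M > 0. For every ε ∈ (0, α] there exist Borel probability measures P and Q on ℝ, each supported on [0,∞), such that: the identity loss satisfies E_P[|x|^{1+λ}] ≤ M and E_Q[|x|^{1+λ}] ≤ M; the Lévy–Prokhorov distance satisfies π(P,Q) ≤ ε; and CVaR_α(id; Q) − CVaR_α(id; P) = (1/α)·M^{1/(1+λ)}·ε^{λ/(1+λ)}. In particular, the tail term ε^{λ/(1+λ)} in the Lévy–Prokhorov continuity bound for CVaR is unavoidable. -/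
open MeasureTheory Real Set

/-- Two-point law `(1-e) δ_0 + e δ_t`. -/
noncomputable def twoPt (e t : ℝ) : Measure ℝ :=
  ENNReal.ofReal (1 - e) • Measure.dirac 0 + ENNReal.ofReal e • Measure.dirac t

lemma twoPt_prob (e t : ℝ) (h0 : 0 ≤ e) (h1 : e ≤ 1) : IsProbabilityMeasure (twoPt e t) := by
  constructor
  simp only [twoPt, Measure.coe_add, Measure.coe_smul, Pi.add_apply, Pi.smul_apply,
    measure_univ, smul_eq_mul, mul_one]
  rw [← ENNReal.ofReal_add (by linarith) h0]
  simp

lemma twoPt_integrable (e t : ℝ) (f : ℝ → ℝ) : Integrable f (twoPt e t) := by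
  refine Integrable.add_measure ?_ ?_
  · exact (integrable_dirac (by simp)).smul_measure ENNReal.ofReal_ne_top
  · exact (integrable_dirac (by simp)).smul_measure ENNReal.ofReal_ne_top

lemma twoPt_integral (e t : ℝ) (h0 : 0 ≤ e) (h1 : e ≤ 1) (f : ℝ → ℝ) :
    ∫ x, f x ∂(twoPt e t) = (1 - e) * f 0 + e * f t := by
  rw [twoPt, integral_add_measure
    ((integrable_dirac (by simp)).smul_measure ENNReal.ofReal_ne_top)
    ((integrable_dirac (by simp)).smul_measure ENNReal.ofReal_ne_top)]
  simp [integral_smul_measure, ENNReal.toReal_ofReal, h0, h1]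

lemma twoPt_neg (e t : ℝ) (ht : 0 ≤ t) : twoPt e t (Set.Iio 0) = 0 := by
  simp [twoPt, ht]

lemma twoPt_cvar (e t α : ℝ) (h0 : 0 ≤ e) (h1 : e ≤ α) (hα : 0 < α) (hα1 : α < 1) (ht : 0 ≤ t) :
    (⨅ θ : ℝ, θ + (1 / α) * ∫ x, max (x - θ) 0 ∂(twoPt e t)) = (1 / α) * (e * t) := by
  have key : ∀ θ : ℝ, (1 / α) * (e * t) ≤ θ + (1 / α) * ∫ x, max (x - θ) 0 ∂(twoPt e t) := by
    intro θ
    rw [twoPt_integral e t h0 (by linarith)]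
    have h : e * t ≤ α * θ + ((1 - e) * max (0 - θ) 0 + e * max (t - θ) 0) := by
      have a1 : e * (t - θ) ≤ e * max (t - θ) 0 := mul_le_mul_of_nonneg_left (le_max_left _ _) h0
      have he : 0 ≤ 1 - e := by linarith
      rcases le_total 0 θ with hθ | hθ
      · have a2 : 0 ≤ (1 - e) * max (0 - θ) 0 := mul_nonneg he (le_max_right _ _)
        nlinarith
      · have a2 : (1 - e) * (0 - θ) ≤ (1 - e) * max (0 - θ) 0 :=
          mul_le_mul_of_nonneg_left (le_max_left _ _) he
        nlinarith
    have h2 := mul_le_mul_of_nonneg_left h (by positivity : 0 ≤ 1 / α)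
    have h3 : 1 / α * (α * θ) = θ := by field_simp
    rw [mul_add, h3] at h2
    exact h2
  apply le_antisymm
  · refine (ciInf_le ⟨(1 / α) * (e * t), ?_⟩ 0).trans ?_
    · rintro _ ⟨θ, rfl⟩
      exact key θ
    · rw [twoPt_integral e t h0 (by linarith)]
      simp [ht]
  · exact le_ciInf key

lemma twoPt_lp (e t : ℝ) (h0 : 0 ≤ e) (h1 : e ≤ 1) :
    levyProkhorovDist (twoPt 0 t) (twoPt e t) ≤ e := by
  have := twoPt_prob 0 t le_rfl zero_le_one
  have := twoPt_prob e t h0 h1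
  refine levyProkhorovDist_le_of_forall_le _ _ h0 ?_
  intro δ B hδ hB
  have hle : twoPt 0 t B ≤ twoPt e t B + ENNReal.ofReal e := by
    have hs : (1 : ENNReal) = ENNReal.ofReal (1 - e) + ENNReal.ofReal e := by
      rw [← ENNReal.ofReal_add (by linarith) h0]; simp
    simp only [twoPt, Measure.coe_add, Measure.coe_smul, Pi.add_apply, Pi.smul_apply, smul_eq_mul,
      sub_zero, ENNReal.ofReal_one, ENNReal.ofReal_zero, zero_mul, add_zero]
    rw [hs, add_mul, add_assoc]
    gcongr
    calc ENNReal.ofReal e * Measure.dirac 0 B ≤ ENNReal.ofReal e * 1 := by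
          gcongr; exact prob_le_one
      _ ≤ _ := by rw [mul_one]; exact le_add_self
  have hd : 0 < δ := by linarith
  refine hle.trans ?_
  gcongr
  exact Metric.self_subset_thickening hd B

/-- **Unavoidability of the tail term in Lévy–Prokhorov continuity of CVaR.**
For `α ∈ (0,1)`, `λ ∈ (0,1]`, `M > 0`, and every `ε ∈ (0,α]`, there exist Borel
probability measures `P, Q` on `ℝ` supported on `[0,∞)` with `(1+λ)`-moments bounded
by `M`, Lévy–Prokhorov distance at most `ε`, and
`CVaR_α(id;Q) - CVaR_α(id;P) = (1/α) M^(1/(1+λ)) ε^(λ/(1+λ))`.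
Hence the tail term `ε^(λ/(1+λ))` is unavoidable. -/
theorem cvar_levy_prokhorov_lower_bound_construction
    (α lam M : ℝ) (hα : α ∈ Set.Ioo (0 : ℝ) 1) (hlam : lam ∈ Set.Ioc (0 : ℝ) 1)
    (hM : 0 < M) (ε : ℝ) (hε : ε ∈ Set.Ioc (0 : ℝ) α) :
    ∃ P Q : Measure ℝ, IsProbabilityMeasure P ∧ IsProbabilityMeasure Q ∧
      P (Set.Iio 0) = 0 ∧ Q (Set.Iio 0) = 0 ∧
      Integrable (fun x => |x| ^ (1 + lam)) P ∧ (∫ x, |x| ^ (1 + lam) ∂P) ≤ M ∧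
      Integrable (fun x => |x| ^ (1 + lam)) Q ∧ (∫ x, |x| ^ (1 + lam) ∂Q) ≤ M ∧
      levyProkhorovDist P Q ≤ ε ∧
      (⨅ θ : ℝ, θ + (1 / α) * ∫ x, max (x - θ) 0 ∂Q)
        - (⨅ θ : ℝ, θ + (1 / α) * ∫ x, max (x - θ) 0 ∂P)
        = (1 / α) * M ^ (1 / (1 + lam)) * ε ^ (lam / (1 + lam)) := by
  obtain ⟨hα0, hα1⟩ := hα
  obtain ⟨hl0, hl1⟩ := hlam
  obtain ⟨he0, he1⟩ := hε
  have hp : 0 < 1 + lam := by linarith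
  set t : ℝ := (M / ε) ^ (1 / (1 + lam)) with ht
  have ht0 : 0 ≤ t := by positivity
  have htp : t ^ (1 + lam) = M / ε := by
    rw [ht, ← Real.rpow_mul (by positivity), one_div_mul_cancel hp.ne', Real.rpow_one]
  have het : ε * t = M ^ (1 / (1 + lam)) * ε ^ (lam / (1 + lam)) := by
    rw [ht, Real.div_rpow hM.le he0.le]
    have : lam / (1 + lam) = 1 - 1 / (1 + lam) := by field_simp; ring
    rw [this, Real.rpow_sub he0, Real.rpow_one]
    ring
  have heq : ε ≤ 1 := by linarith
  refine ⟨twoPt 0 t, twoPt ε t, twoPt_prob _ _ le_rfl zero_le_one, twoPt_prob _ _ he0.le heq,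
    twoPt_neg _ _ ht0, twoPt_neg _ _ ht0, twoPt_integrable _ _ _, ?_, twoPt_integrable _ _ _, ?_,
    twoPt_lp _ _ he0.le heq, ?_⟩
  · rw [twoPt_integral _ _ le_rfl zero_le_one]
    simp [Real.zero_rpow hp.ne', hM.le]
  · rw [twoPt_integral _ _ he0.le heq]
    rw [abs_zero, Real.zero_rpow hp.ne', abs_of_nonneg ht0, htp, mul_div_cancel₀ _ he0.ne']
    simp
  · rw [twoPt_cvar ε t α he0.le he1 hα0 hα1 ht0, twoPt_cvar 0 t α le_rfl hα0.le hα0 hα1 ht0, het]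
    ring
end

section
/- Fix α ∈ (0,1). Let P and Q be probability measures on a measurable space Z, let H be an index set, and let ℓ : H × Z → [0,∞) be such that ℓ(h,·) is measurable for each h ∈ H. Define the tail maps T_h(θ) := P{ z : ℓ(h,z) > θ } and T̂_h(θ) := Q{ z : ℓ(h,z) > θ }, and the thresholds θ*(h) := inf{ θ ∈ ℝ : T_h(θ) ≤ α } and θ̂(h) := inf{ θ ∈ ℝ : T̂_h(θ) ≤ α }. Suppose there are constants ε > 0, u_0 > 0, κ ≥ 1, and c_− > 0 such that: (i) |T̂_h(θ) − T_h(θ)| ≤ ε for all h ∈ H and θ ∈ ℝ; (ii) for all h ∈ H and u ∈ (0, u_0], T_h(θ*(h) − u) ≥ α + c_−·u^κ and T_h(θ*(h) + u) ≤ α − c_−·u^κ; and (iii) ε ≤ (c_−/2)·u_0^κ. Then sup_{h ∈ H} |θ̂(h) − θ*(h)| ≤ (2ε/c_−)^{1/κ}. -/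
open MeasureTheory Real Set

/-- **Uniform deviation of the Rockafellar–Uryasev threshold.**
For `α ∈ (0,1)`, probability measures `P, Q`, tail maps `T_h(θ) = P(ℓ(h,·) > θ)` and
`T̂_h(θ) = Q(ℓ(h,·) > θ)`, and thresholds `θ*(h) = inf{θ : T_h(θ) ≤ α}`,
`θ̂(h) = inf{θ : T̂_h(θ) ≤ α}`, if (i) `|T̂_h(θ) - T_h(θ)| ≤ ε` uniformly, (ii) the
two-sided quantile margin with exponent `κ ≥ 1` and constant `c₋ > 0` holds on
`(0,u₀]`, and (iii) `ε ≤ (c₋/2) u₀^κ`, then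
`sup_h |θ̂(h) - θ*(h)| ≤ (2ε/c₋)^(1/κ)`. -/
theorem ru_threshold_uniform_deviation
    {Z : Type*} [MeasurableSpace Z] {H : Type*}
    (α : ℝ) (hα : α ∈ Set.Ioo (0 : ℝ) 1)
    (P Q : Measure Z) [IsProbabilityMeasure P] [IsProbabilityMeasure Q]
    (ℓ : H → Z → ℝ) (hℓmeas : ∀ h, Measurable (ℓ h)) (hℓnonneg : ∀ h z, 0 ≤ ℓ h z)
    (T That : H → ℝ → ℝ)
    (hT : T = fun h θ => (P {z | θ < ℓ h z}).toReal)
    (hThat : That = fun h θ => (Q {z | θ < ℓ h z}).toReal)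
    (θstar θhat : H → ℝ)
    (hθstar : θstar = fun h => sInf {θ : ℝ | T h θ ≤ α})
    (hθhat : θhat = fun h => sInf {θ : ℝ | That h θ ≤ α})
    (ε u₀ κ cminus : ℝ) (hε : 0 < ε) (hu₀ : 0 < u₀) (hκ : 1 ≤ κ) (hc : 0 < cminus)
    (hdev : ∀ h θ, |That h θ - T h θ| ≤ ε)
    (hmarginL : ∀ h, ∀ u ∈ Set.Ioc (0 : ℝ) u₀, α + cminus * u ^ κ ≤ T h (θstar h - u))
    (hmarginR : ∀ h, ∀ u ∈ Set.Ioc (0 : ℝ) u₀, T h (θstar h + u) ≤ α - cminus * u ^ κ)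
    (hεsmall : ε ≤ (cminus / 2) * u₀ ^ κ) :
    ∀ h : H, |θhat h - θstar h| ≤ (2 * ε / cminus) ^ (1 / κ) := by
  intro h
  have hκ0 : 0 < κ := by linarith
  have hx : 0 < 2 * ε / cminus := by positivity
  set u := (2 * ε / cminus) ^ (1 / κ) with hu
  have hupos : 0 < u := Real.rpow_pos_of_pos hx _
  have hpow : u ^ κ = 2 * ε / cminus := by
    rw [hu, ← Real.rpow_mul hx.le, one_div, inv_mul_cancel₀ hκ0.ne', Real.rpow_one]
  have hcu : cminus * u ^ κ = 2 * ε := by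
    rw [hpow]; field_simp
  have hule : u ≤ u₀ := by
    rw [← Real.rpow_le_rpow_iff hupos.le hu₀.le hκ0]
    have : cminus * u ^ κ ≤ cminus * u₀ ^ κ := by rw [hcu]; linarith
    exact le_of_mul_le_mul_left this hc
  have hL := hmarginL h u ⟨hupos, hule⟩
  have hR := hmarginR h u ⟨hupos, hule⟩
  have hdL := abs_le.mp (hdev h (θstar h - u))
  have hdR := abs_le.mp (hdev h (θstar h + u))
  have hmem : θstar h + u ∈ {θ : ℝ | That h θ ≤ α} := by
    show That h (θstar h + u) ≤ α
    linarith [hdR.2]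
  have hlb : ∀ θ ∈ {θ : ℝ | That h θ ≤ α}, θstar h - u ≤ θ := by
    intro θ hθ
    by_contra hlt
    push Not at hlt
    have hmono : That h (θstar h - u) ≤ That h θ := by
      rw [hThat]
      exact ENNReal.toReal_mono (measure_ne_top _ _)
        (measure_mono fun z hz => lt_trans hlt hz)
    have hθ' : That h θ ≤ α := hθ
    linarith [hdL.1]
  have h1 : θhat h ≤ θstar h + u := by
    rw [hθhat]
    exact csInf_le ⟨_, hlb⟩ hmem
  have h2 : θstar h - u ≤ θhat h := by
    rw [hθhat]
    exact le_csInf ⟨_, hmem⟩ hlb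
  rw [abs_le]
  constructor <;> linarith
end

section
/- Fix α ∈ (0,1). Let P and Q be probability measures on a measurable space Z, let H be an index set, and let ℓ : H × Z → [0,∞) be such that, for each h ∈ H, ℓ(h,·) is measurable and integrable with respect to both P and Q. Define T_h(θ) := P{ z : ℓ(h,z) > θ }, T̂_h(θ) := Q{ z : ℓ(h,z) > θ }, θ*(h) := inf{ θ : T_h(θ) ≤ α }, θ̂(h) := inf{ θ : T̂_h(θ) ≤ α }, and the CVaR objectives R_P(h) := inf_{θ ∈ ℝ} { θ + (1/α)·E_P[(ℓ(h,·) − θ)_+] } and R_Q(h) := inf_{θ ∈ ℝ} { θ + (1/α)·E_Q[(ℓ(h,·) − θ)_+] }. Suppose there are constants ε > 0, u_0 > 0, κ ≥ 1, and 0 < c_− ≤ c_+ < ∞ such that: (i) |T̂_h(θ) − T_h(θ)| ≤ ε for all h ∈ H and θ ∈ ℝ; (ii) for all h ∈ H and u ∈ (0, u_0], α + c_−·u^κ ≤ T_h(θ*(h) − u) ≤ α + c_+·u^κ and α − c_+·u^κ ≤ T_h(θ*(h) + u) ≤ α − c_−·u^κ; and (iii) ε ≤ (c_−/2)·u_0^κ.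 Set Δ := (2ε/c_−)^{1/κ}. Then for every h ∈ H, | R_Q(h) − R_P(h) − (1/α)·( E_Q[(ℓ(h,·) − θ*(h))_+] − E_P[(ℓ(h,·) − θ*(h))_+] ) − (1/α)·(θ̂(h) − θ*(h))·(α − T_h(θ*(h))) | ≤ (1/α)·( ε·Δ + (c_+/(κ+1))·Δ^{κ+1} ). -/
open MeasureTheory Real Set

/-- Subgradient inequality for the (unnormalised) Rockafellar–Uryasev objective. -/
lemma ru_subgradient {Z : Type*} [MeasurableSpace Z] (α : ℝ) (μ : Measure Z)
    [IsProbabilityMeasure μ] (f : Z → ℝ) (hf : Measurable f) (hi : Integrable f μ) (a b : ℝ) :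
    a * α + (∫ z, max (f z - a) 0 ∂μ) + (b - a) * (α - (μ {z | a < f z}).toReal)
      ≤ b * α + ∫ z, max (f z - b) 0 ∂μ := by
  have hint : ∀ c : ℝ, Integrable (fun z => max (f z - c) 0) μ := fun c =>
    (hi.sub (integrable_const c)).pos_part
  have hms : MeasurableSet {z | a < f z} := measurableSet_lt measurable_const hf
  have hind : Integrable ({z | a < f z}.indicator (fun _ => b - a)) μ :=
    (integrable_const (b - a)).indicator hms
  have h1 : ∫ z, max (f z - a) 0 ∂μ
      ≤ ∫ z, (max (f z - b) 0 + {z | a < f z}.indicator (fun _ => b - a) z) ∂μ := by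
    refine integral_mono (hint a) ((hint b).add hind) ?_
    intro z
    by_cases hz : a < f z
    · have hz' : z ∈ {z | a < f z} := hz
      simp only [Set.indicator_of_mem hz']
      rw [max_eq_left (by linarith)]
      linarith [le_max_left (f z - b) 0]
    · have hz' : z ∉ {z | a < f z} := hz
      simp only [Set.indicator_of_notMem hz']
      rw [max_eq_right (by linarith)]
      linarith [le_max_right (f z - b) 0]
  rw [integral_add (hint b) hind, integral_indicator_const _ hms] at h1
  simp only [smul_eq_mul, Measure.real] at h1
  linarith

/-- **Uniform Bahadur–Kiefer expansion for CVaR with endogenous threshold.**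
For `α ∈ (0,1)`, probability measures `P, Q`, tail maps `T_h(θ) = P(ℓ(h,·) > θ)`,
`T̂_h(θ) = Q(ℓ(h,·) > θ)`, thresholds `θ*(h) = inf{θ : T_h(θ) ≤ α}`,
`θ̂(h) = inf{θ : T̂_h(θ) ≤ α}`, and CVaR objectives `R_P, R_Q`, if the uniform tail
deviation bound `ε`, the two-sided quantile margin with constants `c₋ ≤ c₊`,
exponent `κ ≥ 1` on `(0,u₀]`, and `ε ≤ (c₋/2) u₀^κ` hold, then with
`Δ = (2ε/c₋)^(1/κ)`, for every `h`,
`|R_Q(h) - R_P(h) - (1/α)(E_Q[(ℓ_h-θ*)₊] - E_P[(ℓ_h-θ*)₊])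
  - (1/α)(θ̂(h)-θ*(h))(α - T_h(θ*(h)))| ≤ (1/α)(εΔ + (c₊/(κ+1)) Δ^(κ+1))`. -/
theorem cvar_bahadur_kiefer_expansion
    {Z : Type*} [MeasurableSpace Z] {H : Type*}
    (α : ℝ) (hα : α ∈ Set.Ioo (0 : ℝ) 1)
    (P Q : Measure Z) [IsProbabilityMeasure P] [IsProbabilityMeasure Q]
    (ℓ : H → Z → ℝ) (hℓmeas : ∀ h, Measurable (ℓ h)) (hℓnonneg : ∀ h z, 0 ≤ ℓ h z)
    (hℓintP : ∀ h, Integrable (ℓ h) P) (hℓintQ : ∀ h, Integrable (ℓ h) Q)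
    (T That : H → ℝ → ℝ)
    (hT : T = fun h θ => (P {z | θ < ℓ h z}).toReal)
    (hThat : That = fun h θ => (Q {z | θ < ℓ h z}).toReal)
    (θstar θhat : H → ℝ)
    (hθstar : θstar = fun h => sInf {θ : ℝ | T h θ ≤ α})
    (hθhat : θhat = fun h => sInf {θ : ℝ | That h θ ≤ α})
    (RP RQ : H → ℝ)
    (hRP : RP = fun h => ⨅ θ : ℝ, θ + (1 / α) * ∫ z, max (ℓ h z - θ) 0 ∂P)
    (hRQ : RQ = fun h => ⨅ θ : ℝ, θ + (1 / α) * ∫ z, max (ℓ h z - θ) 0 ∂Q)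
    (ε u₀ κ cminus cplus : ℝ)
    (hε : 0 < ε) (hu₀ : 0 < u₀) (hκ : 1 ≤ κ)
    (hcm : 0 < cminus) (hcmp : cminus ≤ cplus)
    (hdev : ∀ h θ, |That h θ - T h θ| ≤ ε)
    (hmarginL : ∀ h, ∀ u ∈ Set.Ioc (0 : ℝ) u₀,
      α + cminus * u ^ κ ≤ T h (θstar h - u) ∧ T h (θstar h - u) ≤ α + cplus * u ^ κ)
    (hmarginR : ∀ h, ∀ u ∈ Set.Ioc (0 : ℝ) u₀,
      α - cplus * u ^ κ ≤ T h (θstar h + u) ∧ T h (θstar h + u) ≤ α - cminus * u ^ κ)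
    (hεsmall : ε ≤ (cminus / 2) * u₀ ^ κ)
    (Δ : ℝ) (hΔ : Δ = (2 * ε / cminus) ^ (1 / κ)) :
    ∀ h : H,
      |RQ h - RP h
        - (1 / α) * ((∫ z, max (ℓ h z - θstar h) 0 ∂Q) - ∫ z, max (ℓ h z - θstar h) 0 ∂P)
        - (1 / α) * (θhat h - θstar h) * (α - T h (θstar h))|
      ≤ (1 / α) * (ε * Δ + (cplus / (κ + 1)) * Δ ^ (κ + 1)) := by
  intro h
  obtain ⟨hα0, hα1⟩ := hα
  have hκ0 : 0 < κ := by linarith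
  have hb0 : 0 < 2 * ε / cminus := by positivity
  have hΔ0 : 0 < Δ := by rw [hΔ]; exact Real.rpow_pos_of_pos hb0 _
  have hΔκ : Δ ^ κ = 2 * ε / cminus := by
    rw [hΔ, ← Real.rpow_mul hb0.le, one_div_mul_cancel hκ0.ne', Real.rpow_one]
  have hcΔ : cminus * Δ ^ κ = 2 * ε := by rw [hΔκ]; field_simp
  have hΔu : Δ ≤ u₀ := by
    by_contra hlt
    push Not at hlt
    have := Real.rpow_lt_rpow hu₀.le hlt hκ0
    have := mul_lt_mul_of_pos_left this hcm
    linarith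
  have hanti : ∀ a b, a ≤ b → T h b ≤ T h a := by
    intro a b hab
    rw [hT]
    exact ENNReal.toReal_mono (measure_ne_top _ _)
      (measure_mono fun z (hz : b < ℓ h z) => lt_of_le_of_lt hab hz)
  have hTge : α ≤ T h (θstar h) := by
    have hlim : Filter.Tendsto (fun u : ℝ => α - cplus * u ^ κ) (nhdsWithin 0 (Set.Ioi 0))
        (nhds α) := by
      have hc : Continuous (fun u : ℝ => α - cplus * u ^ κ) :=
        continuous_const.sub (continuous_const.mul (Real.continuous_rpow_const hκ0.le))
      have := (hc.tendsto 0).mono_left (nhdsWithin_le_nhds (s := Set.Ioi (0 : ℝ)))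
      simpa [Real.zero_rpow hκ0.ne'] using this
    refine le_of_tendsto hlim ?_
    filter_upwards [Ioc_mem_nhdsGT hu₀] with u hu
    exact (hmarginR h u hu).1.trans (hanti _ _ (by linarith [hu.1]))
  have hTle : T h (θstar h) ≤ α := by
    have hpt : ∀ u : ℝ, 0 < u → T h (θstar h + u) ≤ α := by
      intro u hu
      have hm : 0 < min u u₀ := lt_min hu hu₀
      have h1 := (hmarginR h (min u u₀) ⟨hm, min_le_right _ _⟩).2
      have h2 := hanti (θstar h + min u u₀) (θstar h + u) (by linarith [min_le_left u u₀])
      have h3 : 0 < cminus * (min u u₀) ^ κ := mul_pos hcm (Real.rpow_pos_of_pos hm _)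
      linarith
    have hU : {z | θstar h < ℓ h z}
        = ⋃ n : ℕ, {z | θstar h + 1 / ((n : ℝ) + 1) < ℓ h z} := by
      ext z
      simp only [Set.mem_setOf_eq, Set.mem_iUnion]
      constructor
      · intro hz
        obtain ⟨n, hn⟩ := exists_nat_one_div_lt (sub_pos.mpr hz)
        exact ⟨n, by linarith⟩
      · rintro ⟨n, hn⟩
        have : (0 : ℝ) < 1 / ((n : ℝ) + 1) := by positivity
        linarith
    have hmono : Monotone fun n : ℕ => {z | θstar h + 1 / ((n : ℝ) + 1) < ℓ h z} := by
      intro m n hmn z hz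
      simp only [Set.mem_setOf_eq] at hz ⊢
      have := Nat.one_div_le_one_div (α := ℝ) hmn
      linarith
    have hPle : P {z | θstar h < ℓ h z} ≤ ENNReal.ofReal α := by
      rw [hU, hmono.measure_iUnion]
      refine iSup_le fun n => ?_
      rw [ENNReal.le_ofReal_iff_toReal_le (measure_ne_top _ _) hα0.le]
      have := hpt (1 / ((n : ℝ) + 1)) (by positivity)
      rw [hT] at this
      exact this
    have := ENNReal.toReal_mono ENNReal.ofReal_ne_top hPle
    rw [ENNReal.toReal_ofReal hα0.le] at this
    rw [hT]
    exact this
  have hTeq : T h (θstar h) = α := le_antisymm hTle hTge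
  have hsP : ∀ a b : ℝ, a * α + (∫ z, max (ℓ h z - a) 0 ∂P) + (b - a) * (α - T h a)
      ≤ b * α + ∫ z, max (ℓ h z - b) 0 ∂P := by
    intro a b
    rw [hT]
    exact ru_subgradient α P (ℓ h) (hℓmeas h) (hℓintP h) a b
  have hsQ : ∀ a b : ℝ, a * α + (∫ z, max (ℓ h z - a) 0 ∂Q) + (b - a) * (α - That h a)
      ≤ b * α + ∫ z, max (ℓ h z - b) 0 ∂Q := by
    intro a b
    rw [hThat]
    exact ru_subgradient α Q (ℓ h) (hℓmeas h) (hℓintQ h) a b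
  have hconv : ∀ x y : ℝ, x + 1 / α * y = 1 / α * (x * α + y) := by
    intro x y; field_simp
  have hia : 0 ≤ 1 / α := by positivity
  have hPlow : ∀ θ : ℝ, θstar h + (1 / α) * ∫ z, max (ℓ h z - θstar h) 0 ∂P
      ≤ θ + (1 / α) * ∫ z, max (ℓ h z - θ) 0 ∂P := by
    intro θ
    rw [hconv, hconv]
    refine mul_le_mul_of_nonneg_left ?_ hia
    have := hsP (θstar h) θ
    rw [hTeq] at this
    linarith
  have hnear : ∀ θ : ℝ, |θ - θstar h| ≤ Δ →
      θstar h * α + (∫ z, max (ℓ h z - θstar h) 0 ∂Q) - ε * Δ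
        ≤ θ * α + ∫ z, max (ℓ h z - θ) 0 ∂Q := by
    intro θ hθ
    have h1 := hsQ (θstar h) θ
    have h2 := hdev h (θstar h)
    rw [hTeq] at h2
    have h3 : |(θ - θstar h) * (α - That h (θstar h))| ≤ Δ * ε := by
      rw [abs_mul, abs_sub_comm α]
      exact mul_le_mul hθ h2 (abs_nonneg _) hΔ0.le
    have h4 := (abs_le.mp h3).1
    linarith
  have hall : ∀ θ : ℝ,
      θstar h * α + (∫ z, max (ℓ h z - θstar h) 0 ∂Q) - ε * Δ
        ≤ θ * α + ∫ z, max (ℓ h z - θ) 0 ∂Q := by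
    intro θ
    by_cases hθ : |θ - θstar h| ≤ Δ
    · exact hnear θ hθ
    · push Not at hθ
      rcases lt_abs.mp hθ with h1 | h1
      · have h2 := hnear (θstar h + Δ) (by simp [abs_of_pos hΔ0])
        have h3 := hsQ (θstar h + Δ) θ
        have h4 := (abs_le.mp (hdev h (θstar h + Δ))).2
        have h5 := (hmarginR h Δ ⟨hΔ0, hΔu⟩).2
        have h6 : 0 ≤ (θ - (θstar h + Δ)) * (α - That h (θstar h + Δ)) :=
          mul_nonneg (by linarith) (by linarith)
        linarith
      · have h2 := hnear (θstar h - Δ) (by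
          rw [show θstar h - Δ - θstar h = -Δ by ring, abs_neg, abs_of_pos hΔ0])
        have h3 := hsQ (θstar h - Δ) θ
        have h4 := (abs_le.mp (hdev h (θstar h - Δ))).1
        have h5 := (hmarginL h Δ ⟨hΔ0, hΔu⟩).1
        have h6 : 0 ≤ (θ - (θstar h - Δ)) * (α - That h (θstar h - Δ)) :=
          mul_nonneg_of_nonpos_of_nonpos (by linarith) (by linarith)
        linarith
  have hQlow : ∀ θ : ℝ, θstar h + (1 / α) * (∫ z, max (ℓ h z - θstar h) 0 ∂Q)
      - (1 / α) * (ε * Δ) ≤ θ + (1 / α) * ∫ z, max (ℓ h z - θ) 0 ∂Q := by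
    intro θ
    rw [hconv, hconv, ← mul_sub]
    exact mul_le_mul_of_nonneg_left (hall θ) hia
  have hRPeq : RP h = θstar h + (1 / α) * ∫ z, max (ℓ h z - θstar h) 0 ∂P := by
    rw [hRP]
    exact le_antisymm
      (ciInf_le (f := fun θ : ℝ => θ + (1 / α) * ∫ z, max (ℓ h z - θ) 0 ∂P)
        ⟨_, Set.forall_mem_range.mpr hPlow⟩ (θstar h)) (le_ciInf hPlow)
  have hRQle : RQ h ≤ θstar h + (1 / α) * ∫ z, max (ℓ h z - θstar h) 0 ∂Q := by
    rw [hRQ]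
    exact ciInf_le (f := fun θ : ℝ => θ + (1 / α) * ∫ z, max (ℓ h z - θ) 0 ∂Q)
        ⟨_, Set.forall_mem_range.mpr hQlow⟩ (θstar h)
  have hRQge : θstar h + (1 / α) * (∫ z, max (ℓ h z - θstar h) 0 ∂Q)
      - (1 / α) * (ε * Δ) ≤ RQ h := by
    rw [hRQ]
    exact le_ciInf hQlow
  have hextra : 0 ≤ (1 / α) * ((cplus / (κ + 1)) * Δ ^ (κ + 1)) := by
    have : 0 < cplus := by linarith
    positivity
  have hmain : 0 ≤ (1 / α) * (ε * Δ) := by positivity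
  rw [hTeq, hRPeq, sub_self, mul_zero, sub_zero, mul_sub, mul_add, abs_le]
  constructor <;> linarith
end
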